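/- arXiv:2511.08162 — 4 statements merged into one kernel-verified Lean document; each statement's English description precedes it below -/
import Mathlib

section
/- Let A and B be complete lattices and let α : A → B and γ : B → A form a Galois connection (α X ≤ Y ↔ X ≤ γ Y for all X ∈ A, Y ∈ B). Let F : A → A be monotone and define the abstract operator F# : B → B by F# Y = α (F (γ Y)) (which is monotone). Let β : A → Prop be an antitone predicate. Then there exists T ∈ B with F (γ T) ≤ γ T and β (γ T) if and only if β (γ (lfp F#)) holds, where lfp F# is the least fixed point of F#. -/
/-- **Abstract Horn fixed-point theorem, semantic core (Lemma 4.2(1)).**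
Let `A`, `B` be complete lattices with a Galois connection `α : A → B`, `γ : B → A`,
let `F : A → A` be monotone and `F# := α ∘ F ∘ γ` the induced (monotone) abstract
operator, and let `β : A → Prop` be antitone. Then there exists `T : B` with
`F (γ T) ≤ γ T` and `β (γ T)` iff `β (γ (lfp F#))` holds. -/
theorem abstract_horn_fixed_point_iff {A B : Type*} [CompleteLattice A] [CompleteLattice B]
    (α : A → B) (γ : B → A) (gc : GaloisConnection α γ)
    (F : A → A) (hF : Monotone F) (β : A → Prop)
    (hβ : ∀ S S' : A, S ≤ S' → β S' → β S) :
    (∃ T : B, F (γ T) ≤ γ T ∧ β (γ T)) ↔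
      β (γ (OrderHom.lfp
        ⟨fun Y => α (F (γ Y)),
         fun Y Y' h => gc.monotone_l (hF (gc.monotone_u h))⟩)) := by
  constructor
  · rintro ⟨T, hT, hb⟩
    refine hβ _ _ (gc.monotone_u ?_) hb
    exact OrderHom.lfp_le _ ((gc _ _).2 hT)
  · intro hb
    refine ⟨_, ?_, hb⟩
    exact (gc _ _).1 (OrderHom.map_lfp (⟨fun Y => α (F (γ Y)),
      fun Y Y' h => gc.monotone_l (hF (gc.monotone_u h))⟩ : B →o B)).le
end

section
/- Let V be a finite-dimensional vector space over ℚ with finrank ℚ V = n, and let F be a monotone operator on the complete lattice of affine subspaces of V. Then the least fixed point of F equals the (n+1)-fold iterate of F applied to the bottom (empty) affine subspace: lfp F = F^[n+1] ⊥. -/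
theorem iterate_dim_aux {V : Type*} [AddCommGroup V] [Module ℚ V]
    [FiniteDimensional ℚ V]
    (F : AffineSubspace ℚ V → AffineSubspace ℚ V) (hF : Monotone F) (k : ℕ) :
    F (F^[k] ⊥) = F^[k] ⊥ ∨ ((F^[k + 1] ⊥ : AffineSubspace ℚ V) ≠ ⊥ ∧
      k ≤ Module.finrank ℚ (F^[k + 1] ⊥ : AffineSubspace ℚ V).direction) := by
  induction k with
  | zero =>
    by_cases h : F ⊥ = ⊥
    · left; simpa using h
    · right; simpa using h
  | succ k ih =>
    have hs : ∀ j, F^[j + 1] ⊥ = F (F^[j] ⊥) := fun j => Function.iterate_succ_apply' F j ⊥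
    rcases ih with h | ⟨h0, h⟩
    · left
      rw [hs, h, h]
    · by_cases he : F (F^[k + 1] ⊥) = F^[k + 1] ⊥
      · exact Or.inl he
      · right
        have hle : F^[k + 1] ⊥ ≤ F (F^[k + 1] ⊥) := by
          rw [← hs (k + 1)]
          exact hF.monotone_iterate_of_le_map bot_le (Nat.le_succ _)
        have hne := (AffineSubspace.nonempty_iff_ne_bot _).2 h0
        rw [hs (k + 1)]
        generalize F^[k + 1] ⊥ = a at *
        refine ⟨fun hb => h0 (le_bot_iff.1 (hb ▸ hle)), ?_⟩
        have hlt := AffineSubspace.direction_lt_of_nonempty (lt_of_le_of_ne hle (Ne.symm he)) hne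
        have := Submodule.finrank_lt_finrank_of_lt hlt
        omega

/-- **Computation of least fixed points in the lattice of affine subspaces
(decidability of the affine solution problem, Theorem 5.3).**
For a monotone operator `F` on the complete lattice of affine subspaces of an
`n`-dimensional `ℚ`-vector space `V`, the least fixed point of `F` equals the
`(n + 1)`-fold iterate of `F` applied to the bottom (empty) affine subspace. -/
theorem affineSubspace_lfp_eq_iterate {V : Type*} [AddCommGroup V] [Module ℚ V]
    [FiniteDimensional ℚ V] (n : ℕ) (hn : Module.finrank ℚ V = n)
    (F : AffineSubspace ℚ V → AffineSubspace ℚ V) (hF : Monotone F) :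
    OrderHom.lfp ⟨F, hF⟩ = F^[n + 1] ⊥ := by
  have hfix : F (F^[n + 1] ⊥) = F^[n + 1] ⊥ := by
    rcases iterate_dim_aux F hF (n + 1) with h | ⟨_, h⟩
    · exact h
    · have := Submodule.finrank_le (F^[n + 1 + 1] ⊥ : AffineSubspace ℚ V).direction
      omega
  apply le_antisymm
  · exact OrderHom.lfp_le _ hfix.le
  · have key : ∀ k, F^[k] ⊥ ≤ OrderHom.lfp ⟨F, hF⟩ := by
      intro k
      induction k with
      | zero => exact bot_le
      | succ k ih =>
        rw [Function.iterate_succ_apply']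
        exact (hF ih).trans (OrderHom.map_lfp ⟨F, hF⟩).le
    exact key _
end

section
/- Let Σ be a type, B ⊆ Σ a loop guard and c ⊆ Σ × Σ a body relation. Let Γ : Set (Σ × Σ) → Set (Σ × Σ) be the monotone operator Γ X = {(σ,σ') | σ ∈ B ∧ ∃ τ, (σ,τ) ∈ c ∧ (τ,σ') ∈ X} ∪ {(σ,σ) | σ ∉ B}, and let W := lfp Γ be the denotational semantics of the loop 'while B do c'. For ψ ⊆ Σ, define the weakest precondition wp := {σ | ∀ σ', (σ,σ') ∈ W → σ' ∈ ψ}. Then wp = gfp Θ, where Θ : Set Σ → Set Σ is the monotone operator Θ S = (B ∩ {σ | ∀ τ, (σ,τ) ∈ c → τ ∈ S}) ∪ (Bᶜ ∩ ψ). -/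
/-- The monotone operator `Γ` on `Set (St × St)` whose least fixed point is the
denotational semantics of the loop `while B do c`:
`Γ X = {(σ,σ') | σ ∈ B ∧ ∃ τ, (σ,τ) ∈ c ∧ (τ,σ') ∈ X} ∪ {(σ,σ) | σ ∉ B}`. -/
def whileOp {St : Type*} (B : Set St) (c : Set (St × St)) :
    Set (St × St) →o Set (St × St) :=
  ⟨fun X => {p | p.1 ∈ B ∧ ∃ τ, (p.1, τ) ∈ c ∧ (τ, p.2) ∈ X} ∪
      {p | p.1 ∉ B ∧ p.2 = p.1}, by
    intro X Y hXY p hp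
    rcases hp with ⟨hB, τ, hc, hX⟩ | hr
    · exact Or.inl ⟨hB, τ, hc, hXY hX⟩
    · exact Or.inr hr⟩

/-- The monotone operator `Θ S = (B ∩ {σ | ∀ τ, (σ,τ) ∈ c → τ ∈ S}) ∪ (Bᶜ ∩ ψ)`. -/
def wpOp {St : Type*} (B : Set St) (c : Set (St × St)) (ψ : Set St) :
    Set St →o Set St :=
  ⟨fun S => (B ∩ {σ | ∀ τ, (σ, τ) ∈ c → τ ∈ S}) ∪ (Bᶜ ∩ ψ), by
    intro S T hST σ hσ
    rcases hσ with ⟨hB, hall⟩ | hr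
    · exact Or.inl ⟨hB, fun τ hc => hST (hall τ hc)⟩
    · exact Or.inr hr⟩

/-- **The weakest precondition of a while loop is a greatest fixed point
(Theorem 7.12).** With `W := lfp Γ` the denotational semantics of `while B do c`
and `wp := {σ | ∀ σ', (σ,σ') ∈ W → σ' ∈ ψ}` the weakest precondition with respect
to `ψ`, we have `wp = gfp Θ`. -/
theorem wp_while_eq_gfp {St : Type*} (B : Set St) (c : Set (St × St)) (ψ : Set St) :
    {σ | ∀ σ', (σ, σ') ∈ OrderHom.lfp (whileOp B c) → σ' ∈ ψ} =
      OrderHom.gfp (wpOp B c ψ) := by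
  have hW : whileOp B c (OrderHom.lfp (whileOp B c)) ≤ OrderHom.lfp (whileOp B c) :=
    (OrderHom.map_lfp (whileOp B c)).le
  have hG : OrderHom.gfp (wpOp B c ψ) ≤ wpOp B c ψ (OrderHom.gfp (wpOp B c ψ)) :=
    (OrderHom.map_gfp (wpOp B c ψ)).ge
  apply le_antisymm
  · apply OrderHom.le_gfp
    intro σ hσ
    by_cases hB : σ ∈ B
    · exact Or.inl ⟨hB, fun τ hc σ' h => hσ σ' (hW (Or.inl ⟨hB, τ, hc, h⟩))⟩
    · exact Or.inr ⟨hB, hσ σ (hW (Or.inr ⟨hB, rfl⟩))⟩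
  · have key : OrderHom.lfp (whileOp B c) ≤
        {p : St × St | p.1 ∈ OrderHom.gfp (wpOp B c ψ) → p.2 ∈ ψ} := by
      apply OrderHom.lfp_le
      rintro ⟨σ, σ'⟩ hp hσ
      rcases hp with ⟨hB, τ, hc, hX⟩ | ⟨hB, he⟩
      · rcases hG hσ with ⟨_, hall⟩ | ⟨hB', _⟩
        · exact hX (hall τ hc)
        · exact absurd hB hB'
      · rcases hG hσ with ⟨hB', _⟩ | ⟨_, hψ⟩
        · exact absurd hB' hB
        · have he' : σ' = σ := he
          rw [he']
          exact hψ
    intro σ hσ σ' h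
    exact key h hσ
end

section
/- Let Σ be a type, B ⊆ Σ a loop guard and c ⊆ Σ × Σ a body relation. Let Γ : Set (Σ × Σ) → Set (Σ × Σ) be the monotone operator Γ X = {(σ,σ') | σ ∈ B ∧ ∃ τ, (σ,τ) ∈ c ∧ (τ,σ') ∈ X} ∪ {(σ,σ) | σ ∉ B}, and let W := lfp Γ be the denotational semantics of the loop 'while B do c'. For φ ⊆ Σ, define the strongest postcondition sp := {σ' | ∃ σ ∈ φ, (σ,σ') ∈ W}. Then sp = Bᶜ ∩ lfp Λ, where Λ : Set Σ → Set Σ is the monotone operator Λ S = φ ∪ {σ' | ∃ σ ∈ S, σ ∈ B ∧ (σ,σ') ∈ c}. -/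
/-- The monotone operator `Λ S = φ ∪ {σ' | ∃ σ ∈ S, σ ∈ B ∧ (σ,σ') ∈ c}`. -/
def spOp {St : Type*} (B : Set St) (c : Set (St × St)) (φ : Set St) :
    Set St →o Set St :=
  ⟨fun S => φ ∪ {σ' | ∃ σ ∈ S, σ ∈ B ∧ (σ, σ') ∈ c}, by
    intro S T hST σ' hσ'
    rcases hσ' with h1 | ⟨σ, hS, hB, hc⟩
    · exact Or.inl h1
    · exact Or.inr ⟨σ, hST hS, hB, hc⟩⟩

/-- **The strongest postcondition of a while loop is a least fixed point
(Theorem 7.13).** With `W := lfp Γ` the denotational semantics of `while B do c`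
and `sp := {σ' | ∃ σ ∈ φ, (σ,σ') ∈ W}` the strongest postcondition with respect to
`φ`, we have `sp = Bᶜ ∩ lfp Λ`. -/
theorem sp_while_eq_lfp {St : Type*} (B : Set St) (c : Set (St × St)) (φ : Set St) :
    {σ' | ∃ σ ∈ φ, (σ, σ') ∈ OrderHom.lfp (whileOp B c)} =
      Bᶜ ∩ OrderHom.lfp (spOp B c φ) := by
  have hW := OrderHom.map_lfp (whileOp B c)
  have hL := OrderHom.map_lfp (spOp B c φ)
  ext σ'
  constructor
  · rintro ⟨σ, hφ, hσ⟩
    have key : OrderHom.lfp (whileOp B c) ≤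
        {p | p.1 ∈ OrderHom.lfp (spOp B c φ) → p.2 ∈ Bᶜ ∩ OrderHom.lfp (spOp B c φ)} := by
      apply OrderHom.lfp_le
      rintro ⟨a, b⟩ (⟨hB, τ, hc, hX⟩ | ⟨hB, hr⟩) ha
      · apply hX
        rw [← hL]
        exact Or.inr ⟨a, ha, hB, hc⟩
      · dsimp only at hr hB ha ⊢
        subst hr
        exact ⟨hB, ha⟩
    refine key hσ ?_
    rw [← hL]
    exact Or.inl hφ
  · rintro ⟨hB, hσ⟩
    have key : OrderHom.lfp (spOp B c φ) ≤
        {σ | ∀ σ', (σ, σ') ∈ OrderHom.lfp (whileOp B c) →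
          ∃ σ₀ ∈ φ, (σ₀, σ') ∈ OrderHom.lfp (whileOp B c)} := by
      apply OrderHom.lfp_le
      rintro a (ha | ⟨τ, hτ, hτB, hc⟩) b hb
      · exact ⟨a, ha, hb⟩
      · apply hτ
        rw [← hW]
        exact Or.inl ⟨hτB, a, hc, hb⟩
    refine key hσ σ' ?_
    rw [← hW]
    exact Or.inr ⟨hB, rfl⟩
end
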